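/- arXiv:1312.2204 — 3 statements merged into one kernel-verified Lean document; each statement's English description precedes it below -/
import Mathlib

section
/- Let C be a category and E an object of C. Suppose α : 𝟭_C ⟶ Δ_E is a natural transformation from the identity functor of C to the constant functor with value E (i.e., a cocone on the identity functor with vertex E) such that the component α_E : E → E is an isomorphism. Then E is a terminal object of C. -/
open CategoryTheory CategoryTheory.Limits

universe v u

/-- If `α : 𝟭 C ⟶ Δ_E` is a cocone on the identity functor of `C` with vertex `E`
whose component at `E` is an isomorphism, then `E` is a terminal object of `C`. -/
theorem terminal_of_cocone_self_iso {C : Type u} [Category.{v} C] (E : C)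
    (α : 𝟭 C ⟶ (Functor.const C).obj E) (hα : IsIso (α.app E)) :
    Nonempty (IsTerminal E) := by
  have h {X : C} (f : X ⟶ E) : f ≫ α.app E = α.app X := by
    simpa using α.naturality f
  exact ⟨IsTerminal.ofUniqueHom (fun X => α.app X) fun X f =>
    (cancel_mono (α.app E)).1 ((h f).trans (h (α.app X)).symm)⟩
end

section
/- Let E be a locally small cocomplete category which admits a small full subcategory i : C ⥤ E that is strongly generating (the left Kan extension of i along itself is the identity functor of E). Then E has a terminal object. -/
open CategoryTheory CategoryTheory.Limits

universe v u

/-- A locally small cocomplete category admitting a small, strongly generating full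
subcategory (the left Kan extension of the inclusion `i` along itself is the identity
functor) has a terminal object. -/
theorem hasTerminal_of_stronglyGenerating
    {C : Type v} [SmallCategory C] {E : Type u} [Category.{v} E] [HasColimits E]
    (i : C ⥤ E) [i.Full] [i.Faithful]
    [(𝟭 E).IsLeftKanExtension i.rightUnitor.inv] :
    HasTerminal E := by
  -- The colimit of `i` is terminal: its cocone extends to a cocone `t` on the identity functor
  -- whose component at the colimit itself is the identity.
  let α : i ⟶ i ⋙ (Functor.const E).obj (colimit i) :=
    { app := fun c ↦ colimit.ι i c }
  let t : 𝟭 E ⟶ (Functor.const E).obj (colimit i) :=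
    (𝟭 E).descOfIsLeftKanExtension i.rightUnitor.inv _ α
  have t_app (c : C) : t.app (i.obj c) = colimit.ι i c := by
    simpa [α] using (𝟭 E).descOfIsLeftKanExtension_fac_app i.rightUnitor.inv _ α c
  have t_naturality {X Y : E} (f : X ⟶ Y) : f ≫ t.app Y = t.app X := by
    simpa using t.naturality f
  have t_colimit : t.app (colimit i) = 𝟙 (colimit i) :=
    colimit.hom_ext fun c ↦ by
      rw [t_naturality, t_app]
      exact (Category.comp_id _).symm
  have eq_t {X : E} (f : X ⟶ colimit i) : f = t.app X := by
    rw [← t_naturality f, t_colimit]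
    exact (Category.comp_id f).symm
  exact (IsTerminal.ofUniqueHom (fun X ↦ t.app X) fun _ f ↦ eq_t f).hasTerminal
end

section
/- Let i : D ⥤ F be a fully faithful functor admitting a left adjoint a : F ⥤ D which preserves finite limits. Then for every object X of D, the induced functor on slice categories i/X : D/X ⥤ F/i(X), sending an object (f : Y → X) to (i(f) : i(Y) → i(X)), is fully faithful and admits a left adjoint which preserves finite limits. In other words, D/X is a left exact localization of F/i(X). -/
open CategoryTheory CategoryTheory.Limits

universe v₁ v₂ u₁ u₂ w w'

open WithTerminal in
/-- If a functor `G` preserves limits of shape `WithTerminal J`, then the functor it induces on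
over categories preserves limits of shape `J`. -/
theorem preservesLimitsOfShape_over_post {C : Type u₁} [Category.{v₁} C]
    {E : Type u₂} [Category.{v₂} E] {J : Type w} [Category.{w'} J] (B : C) (G : C ⥤ E)
    [PreservesLimitsOfShape (WithTerminal J) G] :
    PreservesLimitsOfShape J (Over.post (X := B) G) where
  preservesLimit {K} :=
    { preserves {c} hc := by
        have hG := isLimitOfPreserves G (isLimitEquiv.symm hc)
        refine ⟨isLimitEquiv <| IsLimit.ofIsoLimit
          ((IsLimit.postcomposeInvEquiv liftFromOverComp _).symm hG) ?_⟩
        refine Cone.ext (Iso.refl _) ?_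
        rintro (j | _) <;> exact (Category.comp_id _).trans (Category.id_comp _).symm }

/-- If `G` preserves finite limits, then so does the functor it induces on over categories. -/
theorem preservesFiniteLimits_over_post {C : Type u₁} [Category.{v₁} C]
    {E : Type u₂} [Category.{v₂} E] (B : C) (G : C ⥤ E) [PreservesFiniteLimits G] :
    PreservesFiniteLimits (Over.post (X := B) G) where
  preservesFiniteLimits _ _ _ := preservesLimitsOfShape_over_post B G

/-- If `i : D ⥤ F` is fully faithful with a finite-limit-preserving left adjoint `a`
(i.e. `D` is a left exact localization of `F`), then for every object `X` of `D` the
induced functor on slice categories `D/X ⥤ F/i(X)` is fully faithful and admits a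
finite-limit-preserving left adjoint, i.e. `D/X` is a left exact localization of
`F/i(X)`. -/
theorem slice_leftExactLocalization
    {D : Type u₁} [Category.{v₁} D] {F : Type u₂} [Category.{v₂} F]
    (i : D ⥤ F) [i.Full] [i.Faithful] (a : F ⥤ D) (adj : a ⊣ i)
    [PreservesFiniteLimits a] (X : D) :
    (Over.post (X := X) i).Full ∧ (Over.post (X := X) i).Faithful ∧
      ∃ L : Over (i.obj X) ⥤ Over X,
        Nonempty (L ⊣ Over.post (X := X) i) ∧ Nonempty (PreservesFiniteLimits L) := by
  refine ⟨inferInstance, inferInstance, _, ⟨Over.postAdjunctionRight adj⟩, ⟨?_⟩⟩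
  have := preservesFiniteLimits_over_post (i.obj X) a
  exact comp_preservesFiniteLimits _ _
end
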